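/- arXiv:2201.08528 — 2 statements merged into one kernel-verified Lean document; each statement's English description precedes it below -/
import Mathlib

section
/- Let N be a positive integer, let x_1, …, x_N be fixed feature vectors, and for each i let the label y_i ∈ {0,1} be sampled independently with y_i = 1 having probability p_i = Pr[y_i = 1 | x_i]. Then for every score vector s ∈ ℝ^N, the expected AUC of the scores s over the random labels is at most the expected AUC of the score vector p = (p_1, …, p_N); that is, the model that predicts the true conditional probabilities p_i maximizes the expected AUC among all score vectors. Formally: E_{y}[AUC(s, y)] ≤ E_{y}[AUC(p, y)] for all s ∈ ℝ^N, where the expectation is over the independent Bernoulli labels y_i ~ Bernoulli(p_i). -/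
open Finset

/-- The AUC (area under the ROC curve) of a score vector `s` with respect to a
binary label vector `y` (`true` = label 1 = positive, `false` = label 0 = negative).
When both classes are nonempty,
`AUC s y = (1/(|P|·|Neg|)) · Σ_{i ∈ P} Σ_{j ∈ Neg} (1[s i > s j] + (1/2)·1[s i = s j])`;
when one of the classes is empty it is the fixed constant `1/2`, independent of `s`. -/
noncomputable def AUC {N : ℕ} (s : Fin N → ℝ) (y : Fin N → Bool) : ℝ :=
  let P : Finset (Fin N) := Finset.univ.filter (fun i => y i = true)
  let Q : Finset (Fin N) := Finset.univ.filter (fun j => y j = false)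
  if P.Nonempty ∧ Q.Nonempty then
    (1 / ((P.card : ℝ) * (Q.card : ℝ))) *
      ∑ i ∈ P, ∑ j ∈ Q,
        ((if s i > s j then (1 : ℝ) else 0) + (1 / 2) * (if s i = s j then (1 : ℝ) else 0))
  else 1 / 2

/-- Pairwise comparison kernel. -/
noncomputable def aucKer {N : ℕ} (s : Fin N → ℝ) (i j : Fin N) : ℝ :=
  (if s i > s j then (1 : ℝ) else 0) + (1 / 2) * (if s i = s j then (1 : ℝ) else 0)

/-- Normalizing constant. -/
noncomputable def aucC {N : ℕ} (y : Fin N → Bool) : ℝ :=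
  1 / (((Finset.univ.filter (fun i => y i = true)).card : ℝ) *
    ((Finset.univ.filter (fun i => y i = false)).card : ℝ))

/-- Constant part of the AUC. -/
noncomputable def aucE {N : ℕ} (y : Fin N → Bool) : ℝ :=
  if (Finset.univ.filter (fun i => y i = true)).Nonempty ∧
    (Finset.univ.filter (fun i => y i = false)).Nonempty then 0 else 1 / 2

/-- Probability weight of a label vector. -/
noncomputable def aucW {N : ℕ} (p : Fin N → ℝ) (y : Fin N → Bool) : ℝ :=
  ∏ i, if y i then p i else 1 - p i

/-- Pair weight. -/
noncomputable def aucK {N : ℕ} (p : Fin N → ℝ) (i j : Fin N) : ℝ :=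
  ∑ y : Fin N → Bool, aucW p y * (aucC y * (if y i = true ∧ y j = false then 1 else 0))

lemma AUC_eq {N : ℕ} (s : Fin N → ℝ) (y : Fin N → Bool) :
    AUC s y = aucE y + ∑ i, ∑ j,
      (aucC y * (if y i = true ∧ y j = false then 1 else 0)) * aucKer s i j := by
  have h : ∑ i, ∑ j, (aucC y * (if y i = true ∧ y j = false then 1 else 0)) * aucKer s i j
      = aucC y * ∑ i ∈ Finset.univ.filter (fun i => y i = true),
        ∑ j ∈ Finset.univ.filter (fun i => y i = false), aucKer s i j := by
    rw [Finset.sum_filter, Finset.mul_sum]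
    refine Finset.sum_congr rfl fun i _ => ?_
    by_cases hi : y i = true
    · simp only [hi, if_true, true_and]
      rw [Finset.sum_filter, Finset.mul_sum]
      refine Finset.sum_congr rfl fun j _ => ?_
      split_ifs <;> simp
    · simp [hi]
  rw [h]
  unfold AUC aucE
  by_cases hh : (Finset.univ.filter (fun i => y i = true)).Nonempty ∧
    (Finset.univ.filter (fun i => y i = false)).Nonempty
  · simp only [if_pos hh, zero_add]
    rfl
  · simp only [if_neg hh]
    have : aucC y = 0 := by
      unfold aucC
      rw [not_and_or, Finset.not_nonempty_iff_eq_empty, Finset.not_nonempty_iff_eq_empty] at hh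
      rcases hh with hh | hh <;> rw [hh] <;> simp
    rw [this]; simp

lemma aucKer_add {N : ℕ} (s : Fin N → ℝ) (i j : Fin N) :
    aucKer s i j + aucKer s j i = 1 := by
  unfold aucKer
  rcases lt_trichotomy (s i) (s j) with h | h | h
  · simp [h, h.not_gt, h.ne, h.ne']
  · simp [h]; norm_num
  · simp [h, h.not_gt, h.ne, h.ne']

lemma aucKer_nonneg {N : ℕ} (s : Fin N → ℝ) (i j : Fin N) : 0 ≤ aucKer s i j := by
  unfold aucKer
  split_ifs <;> norm_num

lemma aucC_nonneg {N : ℕ} (y : Fin N → Bool) : 0 ≤ aucC y := by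
  unfold aucC; positivity

lemma aucC_swap {N : ℕ} (y : Fin N → Bool) (e : Equiv.Perm (Fin N)) :
    aucC (y ∘ e) = aucC y := by
  have h : ∀ b : Bool, (Finset.univ.filter (fun i => (y ∘ e) i = b)).card
      = (Finset.univ.filter (fun i => y i = b)).card := by
    intro b
    rw [Finset.card_filter, Finset.card_filter]
    exact Equiv.sum_comp e (fun i => if y i = b then 1 else 0)
  unfold aucC
  rw [h, h]

lemma aucW_swap_le {N : ℕ} (p : Fin N → ℝ) (hp : ∀ i, p i ∈ Set.Icc (0 : ℝ) 1)
    (i j : Fin N) (hij : p j ≤ p i) (y : Fin N → Bool) (hi : y i = true) (hj : y j = false) :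
    aucW p (y ∘ Equiv.swap i j) ≤ aucW p y := by
  have hne : i ≠ j := by rintro rfl; simp_all
  have key : ∀ f : Fin N → ℝ, ∏ k, f k = f i * (f j * ∏ k ∈ (univ.erase i).erase j, f k) := by
    intro f
    rw [Finset.mul_prod_erase _ _ (by simp [hne.symm]), Finset.mul_prod_erase _ _ (by simp)]
  unfold aucW
  rw [key, key]
  have hr : ∏ k ∈ (univ.erase i).erase j, (if (y ∘ Equiv.swap i j) k then p k else 1 - p k)
      = ∏ k ∈ (univ.erase i).erase j, (if y k then p k else 1 - p k) := by
    refine Finset.prod_congr rfl fun k hk => ?_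
    simp only [Finset.mem_erase, Finset.mem_univ, and_true] at hk
    rw [Function.comp_apply, Equiv.swap_apply_of_ne_of_ne hk.2 hk.1]
  rw [hr]
  have h0 : 0 ≤ ∏ k ∈ (univ.erase i).erase j, (if y k then p k else 1 - p k) := by
    refine Finset.prod_nonneg fun k _ => ?_
    have := hp k
    split_ifs
    · exact this.1
    · linarith [this.2]
  simp only [Function.comp_apply, Equiv.swap_apply_left, Equiv.swap_apply_right, hi, hj,
    if_true, Bool.false_eq_true, if_false]
  rw [← mul_assoc, ← mul_assoc]
  refine mul_le_mul_of_nonneg_right ?_ h0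
  nlinarith

lemma aucK_le {N : ℕ} (p : Fin N → ℝ) (hp : ∀ i, p i ∈ Set.Icc (0 : ℝ) 1)
    (i j : Fin N) (hij : p j ≤ p i) : aucK p j i ≤ aucK p i j := by
  unfold aucK
  rw [← Equiv.sum_comp (Equiv.arrowCongr (Equiv.swap i j) (Equiv.refl Bool))]
  refine Finset.sum_le_sum fun y _ => ?_
  have e : (Equiv.arrowCongr (Equiv.swap i j) (Equiv.refl Bool)) y = y ∘ Equiv.swap i j := by
    ext k; simp [Equiv.arrowCongr]
  rw [e, aucC_swap]
  simp only [Function.comp_apply, Equiv.swap_apply_left, Equiv.swap_apply_right]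
  by_cases h : y i = true ∧ y j = false
  · rw [if_pos h]
    exact mul_le_mul_of_nonneg_right (aucW_swap_le p hp i j hij y h.1 h.2)
      (by simpa using aucC_nonneg y)
  · rw [if_neg h]; simp

lemma expected_eq {N : ℕ} (p s : Fin N → ℝ) :
    ∑ y : Fin N → Bool, aucW p y * AUC s y =
      ∑ y : Fin N → Bool, aucW p y * aucE y + ∑ i, ∑ j, aucK p i j * aucKer s i j := by
  simp only [AUC_eq, mul_add, Finset.sum_add_distrib]
  congr 1
  simp only [aucK, Finset.sum_mul, Finset.mul_sum]
  rw [Finset.sum_comm]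
  refine Finset.sum_congr rfl fun i _ => ?_
  rw [Finset.sum_comm]
  refine Finset.sum_congr rfl fun j _ => Finset.sum_congr rfl fun y _ => ?_
  ring

lemma pair_nonneg {N : ℕ} (p s : Fin N → ℝ) (hp : ∀ i, p i ∈ Set.Icc (0 : ℝ) 1)
    (i j : Fin N) : aucK p i j * aucKer s i j + aucK p j i * aucKer s j i ≤
      aucK p i j * aucKer p i j + aucK p j i * aucKer p j i := by
  have a1 := aucKer_add s i j
  have a3 := aucKer_nonneg s i j
  have a4 := aucKer_nonneg s j i
  have e1 : aucKer s j i = 1 - aucKer s i j := by linarith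
  rcases lt_trichotomy (p i) (p j) with h | h | h
  · have b := aucK_le p hp j i h.le
    have c1 : aucKer p i j = 0 := by simp [aucKer, h.not_gt, h.ne]
    have c2 : aucKer p j i = 1 := by simp [aucKer, h, h.ne']
    rw [c1, c2, e1]; nlinarith
  · have b1 := aucK_le p hp j i h.le
    have b2 := aucK_le p hp i j h.ge
    have b := le_antisymm b1 b2
    have a2 := aucKer_add p i j
    rw [b, ← mul_add, ← mul_add, a1, a2]
  · have b := aucK_le p hp i j h.le
    have c1 : aucKer p j i = 0 := by simp [aucKer, h.not_gt, h.ne]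
    have c2 : aucKer p i j = 1 := by simp [aucKer, h, h.ne']
    rw [c1, c2, e1]; nlinarith

/-- **AUC is proper for fixed feature vectors (Lemma: Theorem 7 of Byrne).**
Let `N` be a positive integer and, for each `i`, let the label `y i ∈ {0,1}` be sampled
independently with `Pr[y i = 1] = p i` (the true conditional probability given the fixed
feature vector `x i`).  Then for every score vector `s ∈ ℝ^N`, the expected AUC of `s`
over the random labels is at most the expected AUC of the score vector `p`:
`E_y[AUC(s, y)] ≤ E_y[AUC(p, y)]`.  The expectation over the independent Bernoulli labels
is written as the explicit sum over all label vectors `y : Fin N → Bool`, each weighted by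
`∏ i, (p i)^{y i} (1 - p i)^{1 - y i}`. -/
theorem expected_auc_maximized_by_true_probabilities
    (N : ℕ) (hN : 0 < N) (p : Fin N → ℝ) (hp : ∀ i, p i ∈ Set.Icc (0 : ℝ) 1)
    (s : Fin N → ℝ) :
    ∑ y : Fin N → Bool, (∏ i, if y i then p i else 1 - p i) * AUC s y ≤
      ∑ y : Fin N → Bool, (∏ i, if y i then p i else 1 - p i) * AUC p y := by
  have h := expected_eq p s
  have h' := expected_eq p p
  unfold aucW at h h'
  rw [h, h']
  refine add_le_add le_rfl ?_
  have sym : ∀ g : Fin N → Fin N → ℝ,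
      2 * ∑ i, ∑ j, g i j = ∑ i, ∑ j, (g i j + g j i) := by
    intro g
    simp only [Finset.sum_add_distrib]
    rw [Finset.sum_comm (f := fun i j => g j i)]
    ring
  have hs := sym (fun i j => aucK p i j * aucKer s i j)
  have hq := sym (fun i j => aucK p i j * aucKer p i j)
  have hle : ∑ i, ∑ j, (aucK p i j * aucKer s i j + aucK p j i * aucKer s j i) ≤
      ∑ i, ∑ j, (aucK p i j * aucKer p i j + aucK p j i * aucKer p j i) :=
    Finset.sum_le_sum fun i _ => Finset.sum_le_sum fun j _ => pair_nonneg p s hp i j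
  linarith
end

section
/- Let (X, Y) be a random pair taking values in a measurable feature space 𝒳 times {0,1}, and let η : 𝒳 → [0,1] be the conditional probability function η(x) = Pr[Y = 1 | X = x]. Let (X_1, Y_1), …, (X_N, Y_N) be N observations sampled i.i.d. from the distribution of (X, Y). Then for every measurable scoring function f : 𝒳 → ℝ, the expected AUC of the score vector (f(X_1), …, f(X_N)) with respect to the labels (Y_1, …, Y_N) is at most the expected AUC of the score vector (η(X_1), …, η(X_N)); that is, the model that predicts the true probabilities Pr[Y = 1 | X = x] optimizes the expected AUC for a set of N observations sampled i.i.d. from the distribution. -/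
open Finset MeasureTheory

namespace AUCAux

/-- Pairwise comparison. -/
noncomputable def sg (a b : ℝ) : ℝ :=
  (if a > b then (1 : ℝ) else 0) + (1 / 2) * (if a = b then (1 : ℝ) else 0)

lemma sg_nonneg (a b : ℝ) : 0 ≤ sg a b := by
  unfold sg; split_ifs <;> norm_num

lemma sg_le_one (a b : ℝ) : sg a b ≤ 1 := by
  unfold sg
  split_ifs with h1 h2 <;> first | (exfalso; linarith) | norm_num

lemma sg_symm (a b : ℝ) : sg b a = 1 - sg a b := by
  unfold sg
  rcases lt_trichotomy a b with h | h | h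
  · simp [h, h.ne, h.ne', not_lt.mpr h.le]
  · simp [h]; norm_num
  · simp [h, h.ne, h.ne', not_lt.mpr h.le]

lemma sg_eq_one {a b : ℝ} (h : b < a) : sg a b = 1 := by
  unfold sg; simp [h, h.ne']

/-- Bernoulli weight. -/
def g (t : ℝ) (b : Bool) : ℝ := if b then t else 1 - t

lemma g_nonneg {t : ℝ} (h : t ∈ Set.Icc (0 : ℝ) 1) (b : Bool) : 0 ≤ g t b := by
  cases b <;> simp [g, h.1, h.2]

/-- Normalising constant. -/
noncomputable def cst {N : ℕ} (y : Fin N → Bool) : ℝ :=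
  1 / (((Finset.univ.filter (fun i => y i = true)).card : ℝ) *
    ((Finset.univ.filter (fun i => y i = false)).card : ℝ))

lemma cst_nonneg {N : ℕ} (y : Fin N → Bool) : 0 ≤ cst y := by
  unfold cst; positivity

/-- Degenerate part. -/
noncomputable def deg {N : ℕ} (y : Fin N → Bool) : ℝ :=
  if (Finset.univ.filter (fun i => y i = true)).Nonempty ∧
    (Finset.univ.filter (fun i => y i = false)).Nonempty then 0 else 1 / 2

lemma deg_nonneg {N : ℕ} (y : Fin N → Bool) : 0 ≤ deg y := by
  unfold deg; split_ifs <;> norm_num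

lemma AUC_eq {N : ℕ} (s : Fin N → ℝ) (y : Fin N → Bool) :
    AUC s y = deg y + ∑ i, ∑ j,
      cst y * (if y i = true ∧ y j = false then 1 else 0) * sg (s i) (s j) := by
  have key : (∑ i, ∑ j,
      cst y * (if y i = true ∧ y j = false then 1 else 0) * sg (s i) (s j)) =
      cst y * ∑ i ∈ Finset.univ.filter (fun i => y i = true),
        ∑ j ∈ Finset.univ.filter (fun i => y i = false), sg (s i) (s j) := by
    rw [Finset.sum_filter, Finset.mul_sum]
    refine Finset.sum_congr rfl fun i _ => ?_
    split_ifs with h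
    · rw [Finset.sum_filter, Finset.mul_sum]
      refine Finset.sum_congr rfl fun j _ => ?_
      by_cases h' : y j = false <;> simp [h, h']
    · simp [h]
  rw [key]
  unfold AUC deg
  simp only
  split_ifs with h
  · rw [zero_add]; rfl
  · rw [not_and_or, Finset.not_nonempty_iff_eq_empty, Finset.not_nonempty_iff_eq_empty] at h
    rcases h with h | h <;> simp [h]

lemma AUC_nonneg {N : ℕ} (s : Fin N → ℝ) (y : Fin N → Bool) : 0 ≤ AUC s y := by
  rw [AUC_eq]
  refine add_nonneg (deg_nonneg y) (Finset.sum_nonneg fun i _ => Finset.sum_nonneg fun j _ => ?_)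
  refine mul_nonneg (mul_nonneg (cst_nonneg y) ?_) (sg_nonneg _ _)
  split_ifs <;> norm_num

lemma AUC_le_one {N : ℕ} (s : Fin N → ℝ) (y : Fin N → Bool) : AUC s y ≤ 1 := by
  unfold AUC
  simp only
  split_ifs with h
  · have h1 : (0 : ℝ) < ((Finset.univ.filter (fun i => y i = true)).card : ℝ) := by
      exact_mod_cast h.1.card_pos
    have h2 : (0 : ℝ) < ((Finset.univ.filter (fun i => y i = false)).card : ℝ) := by
      exact_mod_cast h.2.card_pos
    rw [one_div, inv_mul_le_iff₀ (mul_pos h1 h2), mul_one]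
    calc _ ≤ ∑ i ∈ Finset.univ.filter (fun i => y i = true),
        ∑ j ∈ Finset.univ.filter (fun i => y i = false), (1 : ℝ) :=
          Finset.sum_le_sum fun i _ => Finset.sum_le_sum fun j _ => sg_le_one (s i) (s j)
      _ = _ := by simp
  · norm_num

/-- Pair weight. -/
noncomputable def A {N : ℕ} (p : Fin N → ℝ) (i j : Fin N) : ℝ :=
  ∑ y : Fin N → Bool, (∏ k, g (p k) (y k)) *
    (cst y * (if y i = true ∧ y j = false then 1 else 0))

lemma sum_AUC {N : ℕ} (p s : Fin N → ℝ) :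
    ∑ y : Fin N → Bool, (∏ k, g (p k) (y k)) * AUC s y =
      ∑ y : Fin N → Bool, (∏ k, g (p k) (y k)) * deg y +
        ∑ i, ∑ j, A p i j * sg (s i) (s j) := by
  simp only [AUC_eq, mul_add, Finset.sum_add_distrib, A, Finset.sum_mul, Finset.mul_sum]
  congr 1
  rw [Finset.sum_comm]
  refine Finset.sum_congr rfl fun i _ => ?_
  rw [Finset.sum_comm]
  refine Finset.sum_congr rfl fun j _ => Finset.sum_congr rfl fun y _ => ?_
  ring

lemma cst_swap {N : ℕ} (y : Fin N → Bool) (e : Equiv.Perm (Fin N)) :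
    cst (y ∘ e) = cst y := by
  have h : ∀ b, (Finset.univ.filter (fun i => (y ∘ e) i = b)).card =
      (Finset.univ.filter (fun i => y i = b)).card := by
    intro b
    refine Finset.card_bij (fun a _ => e a) ?_ ?_ ?_
    · simp
    · simp
    · intro c hc
      exact ⟨e.symm c, by simpa using hc, by simp⟩
  unfold cst
  rw [h, h]

lemma A_le {N : ℕ} (p : Fin N → ℝ) (hp : ∀ i, p i ∈ Set.Icc (0 : ℝ) 1) (i j : Fin N)
    (h : p j ≤ p i) : A p j i ≤ A p i j := by
  by_cases hij : i = j
  · subst hij; rfl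
  unfold A
  rw [← Equiv.sum_comp (Equiv.arrowCongr (Equiv.swap i j) (Equiv.refl Bool))]
  refine Finset.sum_le_sum fun y _ => ?_
  have e1 : (Equiv.arrowCongr (Equiv.swap i j) (Equiv.refl Bool)) y = y ∘ Equiv.swap i j := by
    ext k; simp [Equiv.arrowCongr]
  rw [e1, cst_swap]
  simp only [Function.comp_apply, Equiv.swap_apply_left, Equiv.swap_apply_right]
  split_ifs with hy
  · refine mul_le_mul_of_nonneg_right ?_ (by simpa using cst_nonneg y)
    have hj : j ∈ Finset.univ.erase i := by simp [Ne.symm hij]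
    rw [← Finset.mul_prod_erase _ _ (Finset.mem_univ i), ← Finset.mul_prod_erase _ _ hj,
      ← Finset.mul_prod_erase univ (fun k => g (p k) (y k)) (Finset.mem_univ i),
      ← Finset.mul_prod_erase _ (fun k => g (p k) (y k)) hj]
    have e2 : ∏ x ∈ (Finset.univ.erase i).erase j, g (p x) (y (Equiv.swap i j x)) =
        ∏ x ∈ (Finset.univ.erase i).erase j, g (p x) (y x) := by
      refine Finset.prod_congr rfl fun x hx => ?_
      simp only [Finset.mem_erase] at hx
      rw [Equiv.swap_apply_of_ne_of_ne hx.2.1 hx.1]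
    rw [e2, ← mul_assoc, ← mul_assoc]
    refine mul_le_mul_of_nonneg_right ?_ (Finset.prod_nonneg fun x _ => g_nonneg (hp x) _)
    simp only [Equiv.swap_apply_left, Equiv.swap_apply_right, hy.1, hy.2, g]
    simp only [if_true, Bool.false_eq_true, if_false]
    nlinarith
  · simp

lemma pointwise {N : ℕ} (p s : Fin N → ℝ) (hp : ∀ i, p i ∈ Set.Icc (0 : ℝ) 1) :
    ∑ y : Fin N → Bool, (∏ k, g (p k) (y k)) * AUC s y ≤
      ∑ y : Fin N → Bool, (∏ k, g (p k) (y k)) * AUC p y := by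
  rw [sum_AUC, sum_AUC]
  refine add_le_add le_rfl ?_
  have sym : ∀ t : Fin N → ℝ, 2 * ∑ i, ∑ j, A p i j * sg (t i) (t j) =
      ∑ i, ∑ j, (A p i j * sg (t i) (t j) + A p j i * (1 - sg (t i) (t j))) := by
    intro t
    simp only [Finset.sum_add_distrib]
    rw [two_mul]
    congr 1
    rw [Finset.sum_comm]
    refine Finset.sum_congr rfl fun i _ => Finset.sum_congr rfl fun j _ => ?_
    rw [sg_symm]
  have : 2 * ∑ i, ∑ j, A p i j * sg (s i) (s j) ≤ 2 * ∑ i, ∑ j, A p i j * sg (p i) (p j) := by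
    rw [sym, sym]
    refine Finset.sum_le_sum fun i _ => Finset.sum_le_sum fun j _ => ?_
    rcases lt_trichotomy (p i) (p j) with h | h | h
    · have h1 := A_le p hp j i h.le
      have h2 : sg (p i) (p j) = 0 := by rw [sg_symm, sg_eq_one h]; ring
      have h3 := sg_nonneg (s i) (s j)
      rw [h2]; nlinarith
    · have h1 := A_le p hp j i h.le
      have h2 := A_le p hp i j h.ge
      have h3 := le_antisymm h1 h2
      rw [h3]; linarith
    · have h1 := A_le p hp i j h.le
      have h2 := sg_eq_one h
      have h3 := sg_le_one (s i) (s j)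
      rw [h2]; nlinarith
  linarith

lemma measurable_AUC {N : ℕ} (y : Fin N → Bool) : Measurable fun s : Fin N → ℝ => AUC s y := by
  simp only [AUC_eq]
  refine measurable_const.add (Finset.measurable_sum _ fun i _ =>
    Finset.measurable_sum _ fun j _ => measurable_const.mul ?_)
  unfold sg
  refine Measurable.add (Measurable.ite ?_ measurable_const measurable_const)
    (measurable_const.mul (Measurable.ite ?_ measurable_const measurable_const))
  · exact measurableSet_lt (measurable_pi_apply j) (measurable_pi_apply i)
  · exact measurableSet_eq_fun (measurable_pi_apply i) (measurable_pi_apply j)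


lemma g_mass {𝒳 : Type*} [MeasurableSpace 𝒳]
    (μ : Measure (𝒳 × Bool)) [IsProbabilityMeasure μ]
    (η : 𝒳 → ℝ) (hη_meas : Measurable η) (hη01 : ∀ x, η x ∈ Set.Icc (0 : ℝ) 1)
    (hη : ∀ A : Set 𝒳, MeasurableSet A →
      ∫ x in A, η x ∂(μ.map Prod.fst) = (μ (A ×ˢ ({true} : Set Bool))).toReal)
    (B : Set 𝒳) (hB : MeasurableSet B) (b : Bool) :
    ∫⁻ x in B, ENNReal.ofReal (g (η x) b) ∂(μ.map Prod.fst) = μ (B ×ˢ ({b} : Set Bool)) := by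
  have : IsProbabilityMeasure (μ.map Prod.fst) :=
    Measure.isProbabilityMeasure_map measurable_fst.aemeasurable
  have hint : Integrable η (μ.map Prod.fst) :=
    Integrable.of_bound hη_meas.aestronglyMeasurable 1
      (Filter.Eventually.of_forall fun x => by
        rw [Real.norm_eq_abs, abs_of_nonneg (hη01 x).1]; exact (hη01 x).2)
  have key : ∫ x in B, g (η x) b ∂(μ.map Prod.fst) = (μ (B ×ˢ ({b} : Set Bool))).toReal := by
    cases b
    · simp only [g, Bool.false_eq_true, if_false]
      rw [integral_sub (integrable_const _) hint.integrableOn, hη B hB]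
      have h1 : ∫ _ in B, (1 : ℝ) ∂(μ.map Prod.fst) = (μ (Prod.fst ⁻¹' B)).toReal := by
        simp [Measure.real, Measure.map_apply measurable_fst hB]
      rw [h1, sub_eq_iff_eq_add, ← ENNReal.toReal_add (measure_ne_top _ _) (measure_ne_top _ _),
        ← measure_union _ (hB.prod (measurableSet_singleton _))]
      · congr 2
        ext ⟨x, c⟩
        cases c <;> simp
      · rw [Set.disjoint_left]
        rintro ⟨x, c⟩ h h'
        simp at h h'
        simp [h.2] at h'
    · simpa [g] using hη B hB
  have hg : Integrable (fun x => g (η x) b) (μ.map Prod.fst) := by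
    cases b
    · simp only [g, Bool.false_eq_true, if_false]
      exact (integrable_const (1 : ℝ)).sub hint
    · simpa [g] using hint
  rw [← ofReal_integral_eq_lintegral_ofReal hg.integrableOn
    (Filter.Eventually.of_forall fun x => g_nonneg (hη01 x) b), key,
    ENNReal.ofReal_toReal (measure_ne_top _ _)]

lemma measurable_g {𝒳 : Type*} [MeasurableSpace 𝒳] {η : 𝒳 → ℝ} (h : Measurable η) (b : Bool) :
    Measurable fun x => ENNReal.ofReal (g (η x) b) := by
  cases b
  · simpa [g] using (measurable_const.sub h).ennreal_ofReal
  · simpa [g] using h.ennreal_ofReal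

lemma pi_eq_sum {𝒳 : Type*} [MeasurableSpace 𝒳]
    (μ : Measure (𝒳 × Bool)) [IsProbabilityMeasure μ]
    (η : 𝒳 → ℝ) (hη_meas : Measurable η) (hη01 : ∀ x, η x ∈ Set.Icc (0 : ℝ) 1)
    (hη : ∀ A : Set 𝒳, MeasurableSet A →
      ∫ x in A, η x ∂(μ.map Prod.fst) = (μ (A ×ˢ ({true} : Set Bool))).toReal)
    (N : ℕ) :
    Measure.pi (fun _ : Fin N => μ) = Measure.sum fun y : Fin N → Bool =>
      ((Measure.pi (fun _ : Fin N => μ.map Prod.fst)).withDensity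
        (fun x => ∏ k, ENNReal.ofReal (g (η (x k)) (y k)))).map (fun x i => (x i, y i)) := by
  have : IsProbabilityMeasure (μ.map Prod.fst) :=
    Measure.isProbabilityMeasure_map measurable_fst.aemeasurable
  refine Measure.pi_eq fun S hS => ?_
  have hmeas : ∀ b : Bool, Measurable fun x : 𝒳 => (x, b) := fun b => by fun_prop
  have hSb : ∀ i b, MeasurableSet ((fun x : 𝒳 => (x, b)) ⁻¹' S i) := fun i b => hmeas b (hS i)
  have hμ : ∀ i, μ (S i) = ∑ b : Bool, ∫⁻ x in (fun x : 𝒳 => (x, b)) ⁻¹' S i,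
      ENNReal.ofReal (g (η x) b) ∂(μ.map Prod.fst) := by
    intro i
    simp only [g_mass μ η hη_meas hη01 hη _ (hSb i _)]
    rw [Fintype.sum_bool, ← measure_union _ ((hSb i _).prod (measurableSet_singleton _))]
    · congr 1
      ext ⟨x, c⟩
      cases c <;> simp
    · rw [Set.disjoint_left]
      rintro ⟨x, c⟩ h h'
      simp at h h'
      simp [h.2] at h'
  rw [Measure.sum_apply _ (MeasurableSet.univ_pi hS), tsum_fintype]
  simp only [hμ]
  rw [Fintype.prod_sum]
  refine Finset.sum_congr rfl fun y _ => ?_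
  have hm : Measurable fun (x : Fin N → 𝒳) (i : Fin N) => (x i, y i) := by fun_prop
  rw [Measure.map_apply hm (MeasurableSet.univ_pi hS),
    withDensity_apply _ (hm (MeasurableSet.univ_pi hS)),
    ← lintegral_indicator (hm (MeasurableSet.univ_pi hS))]
  let F : Fin N → 𝒳 → ENNReal := fun i =>
    ((fun x : 𝒳 => (x, y i)) ⁻¹' S i).indicator fun x => ENNReal.ofReal (g (η x) (y i))
  have hF : ∀ i, Measurable (F i) := fun i => (measurable_g hη_meas (y i)).indicator (hSb i _)
  have e : ∀ x : Fin N → 𝒳, (((fun (x : Fin N → 𝒳) (i : Fin N) => (x i, y i)) ⁻¹'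
      Set.univ.pi S).indicator fun x => ∏ k, ENNReal.ofReal (g (η (x k)) (y k))) x =
      ∏ i, F i (x i) := by
    intro x
    by_cases hx : ∀ i, (x i, y i) ∈ S i
    · rw [Set.indicator_of_mem (by simpa [Set.mem_pi] using hx)]
      refine Finset.prod_congr rfl fun i _ => ?_
      simp only [F]
      exact (Set.indicator_of_mem (s := (fun x : 𝒳 => (x, y i)) ⁻¹' S i) (hx i)
        (fun x => ENNReal.ofReal (g (η x) (y i)))).symm
    · rw [Set.indicator_of_notMem (by simpa [Set.mem_pi] using hx)]
      push Not at hx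
      obtain ⟨i, hi⟩ := hx
      refine (Finset.prod_eq_zero (Finset.mem_univ i) ?_).symm
      simp only [F]
      exact Set.indicator_of_notMem (s := (fun x : 𝒳 => (x, y i)) ⁻¹' S i) hi _
  rw [lintegral_congr e, ProbabilityTheory.lintegral_prod_eq_prod_lintegral_of_indepFun Finset.univ
    (fun i (x : Fin N → 𝒳) => F i (x i))
    (ProbabilityTheory.iIndepFun_pi fun i => (hF i).aemeasurable)
    (fun i => (hF i).comp (measurable_pi_apply i))]
  refine Finset.prod_congr rfl fun i _ => ?_
  rw [(measurePreserving_eval (fun _ : Fin N => μ.map Prod.fst) i).lintegral_comp (hF i),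
    lintegral_indicator (hSb i _)]

lemma measurable_AUC_comp {𝒳 : Type*} [MeasurableSpace 𝒳] {N : ℕ} {f : 𝒳 → ℝ}
    (hf : Measurable f) :
    Measurable fun ω : Fin N → 𝒳 × Bool => AUC (fun i => f (ω i).1) (fun i => (ω i).2) := by
  have h : Measurable fun q : (Fin N → ℝ) × (Fin N → Bool) => AUC q.1 q.2 :=
    measurable_from_prod_countable_left fun y => measurable_AUC y
  exact h.comp (f := fun ω : Fin N → 𝒳 × Bool => (fun i => f (ω i).1, fun i => (ω i).2))
    (by fun_prop)

lemma lintegral_AUC {𝒳 : Type*} [MeasurableSpace 𝒳]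
    (μ : Measure (𝒳 × Bool)) [IsProbabilityMeasure μ]
    (η : 𝒳 → ℝ) (hη_meas : Measurable η) (hη01 : ∀ x, η x ∈ Set.Icc (0 : ℝ) 1)
    (hη : ∀ A : Set 𝒳, MeasurableSet A →
      ∫ x in A, η x ∂(μ.map Prod.fst) = (μ (A ×ˢ ({true} : Set Bool))).toReal)
    (N : ℕ) (f : 𝒳 → ℝ) (hf : Measurable f) :
    ∫⁻ ω : Fin N → 𝒳 × Bool,
        ENNReal.ofReal (AUC (fun i => f (ω i).1) (fun i => (ω i).2))
        ∂(Measure.pi fun _ : Fin N => μ) =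
      ∫⁻ x : Fin N → 𝒳, ENNReal.ofReal (∑ y : Fin N → Bool,
        (∏ k, g (η (x k)) (y k)) * AUC (fun i => f (x i)) y)
        ∂(Measure.pi fun _ : Fin N => μ.map Prod.fst) := by
  have hA := (measurable_AUC_comp (N := N) hf).ennreal_ofReal
  have hd : ∀ y : Fin N → Bool,
      Measurable fun x : Fin N → 𝒳 => ∏ k, ENNReal.ofReal (g (η (x k)) (y k)) := fun y =>
    Finset.measurable_prod _ fun k _ => (measurable_g hη_meas (y k)).comp (measurable_pi_apply k)
  have hm : ∀ y : Fin N → Bool, Measurable fun (x : Fin N → 𝒳) (i : Fin N) => (x i, y i) :=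
    fun y => by fun_prop
  rw [pi_eq_sum μ η hη_meas hη01 hη N, lintegral_sum_measure, tsum_fintype]
  have hy : ∀ y : Fin N → Bool, Measurable fun x : Fin N → 𝒳 =>
      ENNReal.ofReal (AUC (fun i => f (x i)) y) := fun y =>
    ((measurable_AUC y).comp (f := fun x : Fin N → 𝒳 => fun i => f (x i))
      (by fun_prop)).ennreal_ofReal
  have e1 : ∀ x : Fin N → 𝒳, ENNReal.ofReal (∑ y : Fin N → Bool,
        (∏ k, g (η (x k)) (y k)) * AUC (fun i => f (x i)) y) =
      ∑ y : Fin N → Bool, (∏ k, ENNReal.ofReal (g (η (x k)) (y k))) *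
        ENNReal.ofReal (AUC (fun i => f (x i)) y) := by
    intro x
    have hp : ∀ y : Fin N → Bool, 0 ≤ ∏ k, g (η (x k)) (y k) := fun y =>
      Finset.prod_nonneg fun k _ => g_nonneg (hη01 _) _
    rw [ENNReal.ofReal_sum_of_nonneg fun y _ => mul_nonneg (hp y) (AUC_nonneg _ _)]
    refine Finset.sum_congr rfl fun y _ => ?_
    rw [ENNReal.ofReal_mul (hp y),
      ENNReal.ofReal_prod_of_nonneg fun k _ => g_nonneg (hη01 _) _]
  have hdy : ∀ y : Fin N → Bool, Measurable fun x : Fin N → 𝒳 =>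
      (∏ k, ENNReal.ofReal (g (η (x k)) (y k))) * ENNReal.ofReal (AUC (fun i => f (x i)) y) :=
    fun y => (hd y).mul (hy y)
  rw [lintegral_congr e1, lintegral_finsetSum _ fun y _ => hdy y]
  refine Finset.sum_congr rfl fun y _ => ?_
  rw [lintegral_map hA (hm y)]
  exact lintegral_withDensity_eq_lintegral_mul _ (hd y) (hy y)

end AUCAux

/-- **AUC is proper (Theorem 1).**
Let `(X, Y)` be a random pair with values in a measurable feature space `𝒳 × {0,1}`
(labels modelled by `Bool`, `true` = 1), with joint law `μ`, and let
`η(x) = Pr[Y = 1 | X = x]` be the conditional probability function, i.e. a measurable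
function with values in `[0,1]` satisfying `∫_{x ∈ A} η(x) d(law of X) = μ(A × {1})`
for every measurable `A ⊆ 𝒳`.  Let `(X_1,Y_1), …, (X_N,Y_N)` be `N` observations
sampled i.i.d. from `μ` (joint law: the product measure on `Fin N → 𝒳 × Bool`).
Then for every measurable scoring function `f : 𝒳 → ℝ`, the expected AUC of the
score vector `(f(X_1), …, f(X_N))` with respect to the labels `(Y_1, …, Y_N)` is at
most the expected AUC of the score vector `(η(X_1), …, η(X_N))`: the model predicting
the true probabilities optimizes the expected AUC. -/
theorem expected_auc_maximized_by_conditional_probability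
    {𝒳 : Type*} [MeasurableSpace 𝒳]
    (μ : Measure (𝒳 × Bool)) [IsProbabilityMeasure μ]
    (η : 𝒳 → ℝ) (hη_meas : Measurable η) (hη01 : ∀ x, η x ∈ Set.Icc (0 : ℝ) 1)
    (hη : ∀ A : Set 𝒳, MeasurableSet A →
      ∫ x in A, η x ∂(μ.map Prod.fst) = (μ (A ×ˢ ({true} : Set Bool))).toReal)
    (N : ℕ) (hN : 0 < N) (f : 𝒳 → ℝ) (hf : Measurable f) :
    ∫ ω : Fin N → 𝒳 × Bool,
        AUC (fun i => f (ω i).1) (fun i => (ω i).2)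
        ∂(Measure.pi fun _ : Fin N => μ) ≤
      ∫ ω : Fin N → 𝒳 × Bool,
        AUC (fun i => η (ω i).1) (fun i => (ω i).2)
        ∂(Measure.pi fun _ : Fin N => μ) := by
  have h1 := AUCAux.measurable_AUC_comp (N := N) hf
  have h2 := AUCAux.measurable_AUC_comp (N := N) hη_meas
  rw [integral_eq_lintegral_of_nonneg_ae
      (Filter.Eventually.of_forall fun ω => AUCAux.AUC_nonneg _ _) h1.aestronglyMeasurable,
    integral_eq_lintegral_of_nonneg_ae
      (Filter.Eventually.of_forall fun ω => AUCAux.AUC_nonneg _ _) h2.aestronglyMeasurable]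
  refine ENNReal.toReal_mono ?_ ?_
  · refine ne_top_of_le_ne_top ENNReal.one_ne_top ?_
    calc _ ≤ ∫⁻ _ : Fin N → 𝒳 × Bool, 1 ∂(Measure.pi fun _ : Fin N => μ) :=
          lintegral_mono fun ω => by
            simpa using AUCAux.AUC_le_one (fun i => η (ω i).1) (fun i => (ω i).2)
      _ = 1 := by simp
  · rw [AUCAux.lintegral_AUC μ η hη_meas hη01 hη N f hf,
      AUCAux.lintegral_AUC μ η hη_meas hη01 hη N η hη_meas]
    exact lintegral_mono fun x => ENNReal.ofReal_le_ofReal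
      (AUCAux.pointwise (fun i => η (x i)) (fun i => f (x i)) fun i => hη01 _)
end
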